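/- Grünbaum's theorem: for any compact convex body K ⊂ ℝ^d with nonempty interior and any hyperplane h passing through the center of gravity of K, each of the two pieces into which h divides K has volume at least e^{-1} times the volume of K. -/

import Mathlib

open MeasureTheory RealInnerProductSpace
open Set
open scoped ENNReal Pointwise

/-- The Prékopa–Leindler inequality for the measure `μ`. -/
def PrekopaLeindler {E : Type*} [AddCommGroup E] [Module ℝ E] [MeasurableSpace E]
    (μ : Measure E) : Prop :=
  ∀ ⦃a b : ℝ⦄, 0 < a → 0 < b → a + b = 1 → ∀ ⦃f g h : E → ℝ≥0∞⦄,
    Measurable f → Measurable g → Measurable h →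
    (∀ x y, f x ^ a * g y ^ b ≤ h (a • x + b • y)) →
    (∫⁻ x, f x ∂μ) ^ a * (∫⁻ x, g x ∂μ) ^ b ≤ ∫⁻ x, h x ∂μ

theorem ENNReal.rpow_mul_rpow_le_weighted_add {a b : ℝ} (ha : 0 < a) (hb : 0 < b)
    (hab : a + b = 1) (x y : ℝ≥0∞) :
    x ^ a * y ^ b ≤ ENNReal.ofReal a * x + ENNReal.ofReal b * y := by
  have hpq : (a⁻¹).HolderConjugate b⁻¹ :=
    Real.holderConjugate_iff.2 ⟨(one_lt_inv₀ ha).2 (by linarith), by simpa using hab⟩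
  have := ENNReal.young_inequality (x ^ a) (y ^ b) hpq
  rw [← ENNReal.rpow_mul, ← ENNReal.rpow_mul, mul_inv_cancel₀ ha.ne', mul_inv_cancel₀ hb.ne',
    ENNReal.rpow_one, ENNReal.rpow_one, ENNReal.ofReal_inv_of_pos ha,
    ENNReal.ofReal_inv_of_pos hb] at this
  simpa [div_eq_mul_inv, mul_comm] using this

theorem Real.volume_add_volume_le_of_isCompact {A B : Set ℝ} (hA : IsCompact A)
    (hB : IsCompact B) (hA' : A.Nonempty) (hB' : B.Nonempty) :
    volume A + volume B ≤ volume (A + B) := by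
  obtain ⟨p, hp⟩ := hA.exists_isGreatest hA'
  obtain ⟨q, hq⟩ := hB.exists_isLeast hB'
  have h1 : volume (q +ᵥ A) = volume A := measure_vadd _ _ _
  have h2 : volume (p +ᵥ B) = volume B := measure_vadd _ _ _
  have hd : AEDisjoint volume (q +ᵥ A) (p +ᵥ B) := by
    refine measure_mono_null (t := {p + q}) ?_ (by simp)
    rintro _ ⟨⟨x, hx, rfl⟩, ⟨y, hy, hxy⟩⟩
    have := hp.2 hx
    have := hq.2 hy
    simp only [vadd_eq_add, mem_singleton_iff] at hxy ⊢
    linarith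
  rw [← h1, ← h2, ← measure_union₀ ((hB.vadd p).measurableSet.nullMeasurableSet) hd]
  refine measure_mono (union_subset ?_ ?_)
  · rintro _ ⟨x, hx, rfl⟩
    exact ⟨x, hx, q, hq.1, add_comm _ _⟩
  · rintro _ ⟨x, hx, rfl⟩
    exact ⟨p, hp.1, x, hx, rfl⟩

theorem Real.weighted_volume_add_le {a b : ℝ} (ha : 0 < a) (hb : 0 < b) {A B C : Set ℝ}
    (hA : MeasurableSet A) (hB : MeasurableSet B) (hA' : A.Nonempty) (hB' : B.Nonempty)
    (hC : ∀ x ∈ A, ∀ y ∈ B, a * x + b * y ∈ C) :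
    ENNReal.ofReal a * volume A + ENNReal.ofReal b * volume B ≤ volume C := by
  have key : ∀ K ⊆ A, IsCompact K → K.Nonempty → ∀ L ⊆ B, IsCompact L → L.Nonempty →
      ENNReal.ofReal a * volume K + ENNReal.ofReal b * volume L ≤ volume C := by
    intro K hKA hK hK' L hLB hL hL'
    have hKa : volume (a • K) = ENNReal.ofReal a * volume K := by
      simp [Measure.addHaar_smul, abs_of_pos ha]
    have hLb : volume (b • L) = ENNReal.ofReal b * volume L := by
      simp [Measure.addHaar_smul, abs_of_pos hb]
    rw [← hKa, ← hLb]
    refine (Real.volume_add_volume_le_of_isCompact (hK.smul a) (hL.smul b) hK'.smul_set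
      hL'.smul_set).trans (measure_mono ?_)
    rintro _ ⟨_, ⟨x, hx, rfl⟩, _, ⟨y, hy, rfl⟩, rfl⟩
    exact hC x (hKA hx) y (hLB hy)
  obtain ⟨x₀, hx₀⟩ := hA'
  obtain ⟨y₀, hy₀⟩ := hB'
  have key' : ∀ K ⊆ A, IsCompact K → ∀ L ⊆ B, IsCompact L →
      ENNReal.ofReal a * volume K + ENNReal.ofReal b * volume L ≤ volume C := by
    intro K hKA hK L hLB hL
    refine le_trans ?_ (key (insert x₀ K) (insert_subset hx₀ hKA) (hK.insert _)
      (insert_nonempty _ _) (insert y₀ L) (insert_subset hy₀ hLB) (hL.insert _)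
      (insert_nonempty _ _))
    gcongr <;> exact subset_insert _ _
  rw [hA.measure_eq_iSup_isCompact, hB.measure_eq_iSup_isCompact]
  simp only [ENNReal.mul_iSup, iSup_and']
  exact ENNReal.biSup_add_biSup_le' ⟨∅, empty_subset _, isCompact_empty⟩
    ⟨∅, empty_subset _, isCompact_empty⟩ fun K hK L hL => key' K hK.1 hK.2 L hL.1 hL.2

theorem lintegral_eq_lintegral_measure_ofReal_le {α : Type*} [MeasurableSpace α] (μ : Measure α)
    {f : α → ℝ≥0∞} (hf : Measurable f) (hf' : ∀ x, f x ≠ ∞) :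
    ∫⁻ x, f x ∂μ = ∫⁻ t in Ioi (0 : ℝ), μ {x | ENNReal.ofReal t ≤ f x} := by
  have := lintegral_eq_lintegral_meas_le μ (f := fun x => (f x).toReal)
    (.of_forall fun x => ENNReal.toReal_nonneg) hf.ennreal_toReal.aemeasurable
  simp only [ENNReal.ofReal_toReal (hf' _)] at this
  simpa only [ENNReal.ofReal_le_iff_le_toReal (hf' _)] using this

theorem Real.prekopaLeindler_of_normalized {a b : ℝ} (ha : 0 < a) (hb : 0 < b) (hab : a + b = 1)
    {f g h : ℝ → ℝ≥0∞} (hf : Measurable f) (hg : Measurable g) (hh : Measurable h)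
    (hfgh : ∀ x y, f x ^ a * g y ^ b ≤ h (a • x + b • y))
    (hf₁ : ⨆ x, f x = 1) (hg₁ : ⨆ x, g x = 1) :
    (∫⁻ x, f x) ^ a * (∫⁻ x, g x) ^ b ≤ ∫⁻ x, h x := by
  refine (ENNReal.rpow_mul_rpow_le_weighted_add ha hb hab _ _).trans ?_
  have hf1 : ∀ x, f x ≤ 1 := fun x => hf₁ ▸ le_iSup f x
  have hg1 : ∀ x, g x ≤ 1 := fun x => hg₁ ▸ le_iSup g x
  refine le_trans ?_ (lintegral_mono (fun x => min_le_left (h x) 1))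
  rw [lintegral_eq_lintegral_measure_ofReal_le _ hf fun x => ne_top_of_le_ne_top (by simp) (hf1 x),
    lintegral_eq_lintegral_measure_ofReal_le _ hg fun x => ne_top_of_le_ne_top (by simp) (hg1 x),
    lintegral_eq_lintegral_measure_ofReal_le _ (hh.min measurable_const)
      fun x => ne_top_of_le_ne_top (by simp) (min_le_right _ _),
    ← lintegral_const_mul' _ _ (by simp), ← lintegral_const_mul' _ _ (by simp)]
  refine (le_lintegral_add _ _).trans (lintegral_mono_ae ?_)
  have h1 : ∀ᵐ t : ℝ ∂volume.restrict (Ioi 0), t ≠ 1 :=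
    ae_restrict_of_ae (Measure.ae_ne _ 1)
  filter_upwards [h1, ae_restrict_mem measurableSet_Ioi] with t ht1 ht0
  rcases lt_or_gt_of_ne ht1 with ht | ht
  · have ht' : ENNReal.ofReal t < 1 := by simpa using ht
    obtain ⟨x, hx⟩ := lt_iSup_iff.1 (hf₁ ▸ ht')
    obtain ⟨y, hy⟩ := lt_iSup_iff.1 (hg₁ ▸ ht')
    refine Real.weighted_volume_add_le ha hb (measurableSet_le measurable_const hf)
      (measurableSet_le measurable_const hg) ⟨x, hx.le⟩ ⟨y, hy.le⟩ ?_
    intro x hx y hy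
    refine le_min (le_trans ?_ (hfgh x y)) ht'.le
    calc ENNReal.ofReal t = ENNReal.ofReal t ^ a * ENNReal.ofReal t ^ b := by
          rw [← ENNReal.rpow_add_of_nonneg _ _ ha.le hb.le, hab, ENNReal.rpow_one]
      _ ≤ _ := by gcongr <;> assumption
  · have ht' : 1 < ENNReal.ofReal t := by simpa using ht
    have e1 : {x | ENNReal.ofReal t ≤ f x} = ∅ :=
      eq_empty_of_forall_notMem fun x hx => (ht'.trans_le hx).not_ge (hf1 x)
    have e2 : {x | ENNReal.ofReal t ≤ g x} = ∅ :=
      eq_empty_of_forall_notMem fun x hx => (ht'.trans_le hx).not_ge (hg1 x)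
    simp [e1, e2]

theorem Real.prekopaLeindler_of_iSup_ne_top {a b : ℝ} (ha : 0 < a) (hb : 0 < b) (hab : a + b = 1)
    {f g h : ℝ → ℝ≥0∞} (hf : Measurable f) (hg : Measurable g) (hh : Measurable h)
    (hfgh : ∀ x y, f x ^ a * g y ^ b ≤ h (a • x + b • y))
    (hf₁ : ⨆ x, f x ≠ ∞) (hg₁ : ⨆ x, g x ≠ ∞) :
    (∫⁻ x, f x) ^ a * (∫⁻ x, g x) ^ b ≤ ∫⁻ x, h x := by
  rcases eq_or_ne (⨆ x, f x) 0 with hf0 | hf0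
  · simp [ENNReal.iSup_eq_zero.1 hf0, ha]
  rcases eq_or_ne (⨆ x, g x) 0 with hg0 | hg0
  · simp [ENNReal.iSup_eq_zero.1 hg0, hb]
  set p := ⨆ x, f x
  set q := ⨆ x, g x
  have hpq0 : p ^ a * q ^ b ≠ 0 := by
    simp [hf0, hg0, hf₁, hg₁, ENNReal.rpow_eq_zero_iff]
  have hpq1 : p ^ a * q ^ b ≠ ∞ := by
    refine ENNReal.mul_ne_top ?_ ?_ <;> simp [hf0, hg0, hf₁, hg₁, ENNReal.rpow_eq_top_iff]
  have hmul : ∀ u v : ℝ≥0∞, (p⁻¹ * u) ^ a * (q⁻¹ * v) ^ b = (p ^ a * q ^ b)⁻¹ * (u ^ a * v ^ b) := by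
    intro u v
    rw [ENNReal.mul_rpow_of_nonneg _ _ ha.le, ENNReal.mul_rpow_of_nonneg _ _ hb.le,
      ENNReal.inv_rpow, ENNReal.inv_rpow, ENNReal.mul_inv (by simp [hf0, hf₁, ENNReal.rpow_eq_zero_iff])
      (by simp [hf0, hf₁, ENNReal.rpow_eq_top_iff])]
    ring
  have := Real.prekopaLeindler_of_normalized ha hb hab (hf.const_mul p⁻¹) (hg.const_mul q⁻¹)
    (hh.const_mul (p ^ a * q ^ b)⁻¹) (fun x y => by rw [hmul]; gcongr; exact hfgh x y)
    (by rw [← ENNReal.mul_iSup, ENNReal.inv_mul_cancel hf0 hf₁])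
    (by rw [← ENNReal.mul_iSup, ENNReal.inv_mul_cancel hg0 hg₁])
  rw [lintegral_const_mul _ hf, lintegral_const_mul _ hg, lintegral_const_mul _ hh, hmul] at this
  exact (ENNReal.mul_le_mul_iff_right (ENNReal.inv_ne_zero.2 hpq1) (ENNReal.inv_ne_top.2 hpq0)).1 this

theorem ENNReal.lintegral_eq_iSup_lintegral_min {α : Type*} [MeasurableSpace α] (μ : Measure α)
    {f : α → ℝ≥0∞} (hf : Measurable f) :
    ∫⁻ x, f x ∂μ = ⨆ n : ℕ, ∫⁻ x, min (f x) n ∂μ := by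
  rw [← lintegral_iSup (fun n => hf.min measurable_const)
    (fun m n hmn x => min_le_min_left _ (by exact_mod_cast hmn))]
  congr with x
  refine le_antisymm ?_ (iSup_le fun n => min_le_left _ _)
  refine le_of_forall_lt fun c hc => ?_
  obtain ⟨n, hn⟩ := ENNReal.exists_nat_gt hc.ne_top
  exact lt_iSup_iff.2 ⟨n, lt_min hc hn⟩

theorem Real.prekopaLeindler : PrekopaLeindler (volume : Measure ℝ) := by
  intro a b ha hb hab f g h hf hg hh hfgh
  have key : ∀ n : ℕ, (∫⁻ x, min (f x) n) ^ a * (∫⁻ x, min (g x) n) ^ b ≤ ∫⁻ x, h x := by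
    intro n
    refine Real.prekopaLeindler_of_iSup_ne_top ha hb hab (hf.min measurable_const)
      (hg.min measurable_const) hh (fun x y => le_trans ?_ (hfgh x y))
      (ne_top_of_le_ne_top (ENNReal.natCast_ne_top n) (iSup_le fun x => min_le_right _ _))
      (ne_top_of_le_ne_top (ENNReal.natCast_ne_top n) (iSup_le fun x => min_le_right _ _))
    gcongr <;> exact min_le_left _ _
  rw [ENNReal.lintegral_eq_iSup_lintegral_min _ hf, ENNReal.lintegral_eq_iSup_lintegral_min _ hg]
  have e1 := (ENNReal.orderIsoRpow a ha).map_iSup (fun n : ℕ => ∫⁻ x, min (f x) n)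
  have e2 := (ENNReal.orderIsoRpow b hb).map_iSup (fun n : ℕ => ∫⁻ x, min (g x) n)
  simp only [ENNReal.orderIsoRpow_apply] at e1 e2
  simp only [e1, e2, ENNReal.iSup_mul, ENNReal.mul_iSup]
  refine iSup_le fun i => iSup_le fun j => le_trans ?_ (key (max i j))
  gcongr
  · exact le_max_right i j
  · exact le_max_left i j

theorem PrekopaLeindler.prod {E F : Type*} [AddCommGroup E] [Module ℝ E] [MeasurableSpace E]
    [AddCommGroup F] [Module ℝ F] [MeasurableSpace F] {μ : Measure E} {ν : Measure F} [SFinite ν]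
    (hμ : PrekopaLeindler μ) (hν : PrekopaLeindler ν) : PrekopaLeindler (μ.prod ν) := by
  intro a b ha hb hab f g h hf hg hh hfgh
  rw [lintegral_prod _ hf.aemeasurable, lintegral_prod _ hg.aemeasurable,
    lintegral_prod _ hh.aemeasurable]
  refine hμ ha hb hab hf.lintegral_prod_right' hg.lintegral_prod_right' hh.lintegral_prod_right'
    fun s t => ?_
  exact hν ha hb hab (hf.comp measurable_prodMk_left) (hg.comp measurable_prodMk_left)
    (hh.comp measurable_prodMk_left) fun x y => hfgh (s, x) (t, y)

theorem PrekopaLeindler.of_measurePreserving {E F : Type*} [AddCommGroup E] [Module ℝ E]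
    [MeasurableSpace E] [AddCommGroup F] [Module ℝ F] [MeasurableSpace F] {μ : Measure E}
    {ν : Measure F} (hμ : PrekopaLeindler μ) (e : E →ₗ[ℝ] F) (he : MeasurePreserving e μ ν) :
    PrekopaLeindler ν := by
  intro a b ha hb hab f g h hf hg hh hfgh
  rw [← he.lintegral_comp hf, ← he.lintegral_comp hg, ← he.lintegral_comp hh]
  refine hμ ha hb hab (hf.comp he.measurable) (hg.comp he.measurable) (hh.comp he.measurable)
    fun x y => ?_
  simpa using hfgh (e x) (e y)

theorem Pi.prekopaLeindler (n : ℕ) : PrekopaLeindler (volume : Measure (Fin n → ℝ)) := by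
  induction n with
  | zero =>
    intro a b ha hb hab f g h hf hg hh hfgh
    let _ : Inhabited (Fin 0 → ℝ) := Unique.instInhabited
    have := hfgh default default
    rw [Subsingleton.elim (a • default + b • default) (default : Fin 0 → ℝ)] at this
    simpa only [lintegral_unique, volume_pi, Measure.pi_univ, Finset.univ_eq_empty,
      Finset.prod_empty, mul_one] using this
  | succ n ih =>
    let e : ℝ × (Fin n → ℝ) →ₗ[ℝ] (Fin (n + 1) → ℝ) :=
      (Fin.consLinearEquiv ℝ (fun _ : Fin (n + 1) => ℝ)).toLinearMap
    refine (Real.prekopaLeindler.prod ih).of_measurePreserving e ?_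
    have := (volume_preserving_piFinSuccAbove (fun _ : Fin (n + 1) => ℝ) 0).symm
    convert! this using 1
    ext x i
    refine Fin.cases ?_ (fun i => ?_) i <;>
      simp [e, MeasurableEquiv.piFinSuccAbove_symm_apply]

theorem EuclideanSpace.prekopaLeindler (n : ℕ) :
    PrekopaLeindler (volume : Measure (EuclideanSpace ℝ (Fin n))) :=
  (Pi.prekopaLeindler n).of_measurePreserving
    (WithLp.linearEquiv 2 ℝ (Fin n → ℝ)).symm.toLinearMap (PiLp.volume_preserving_toLp (Fin n))

theorem PrekopaLeindler.measure_rpow_mul_le {E : Type*} [AddCommGroup E] [Module ℝ E]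
    [MeasurableSpace E] {μ : Measure E} (hμ : PrekopaLeindler μ) {a b : ℝ} (ha : 0 < a)
    (hb : 0 < b) (hab : a + b = 1) {A B C : Set E} (hA : MeasurableSet A) (hB : MeasurableSet B)
    (hC : MeasurableSet C) (h : ∀ x ∈ A, ∀ y ∈ B, a • x + b • y ∈ C) :
    μ A ^ a * μ B ^ b ≤ μ C := by
  have := hμ ha hb hab (measurable_one.indicator hA) (measurable_one.indicator hB)
    (measurable_one.indicator hC) fun x y => ?_
  · simpa [lintegral_indicator_one, hA, hB, hC] using this
  · by_cases hx : x ∈ A <;> by_cases hy : y ∈ B <;> simp [hx, hy, ha, hb, h]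

theorem ConcaveOn.exists_le_add_mul {S : Set ℝ} {f : ℝ → ℝ} (hf : ConcaveOn ℝ S f) {c : ℝ}
    (hc : c ∈ interior S) : ∃ m, ∀ x ∈ S, f x ≤ f c + m * (x - c) := by
  have hcS := interior_subset hc
  have hd : DifferentiableWithinAt ℝ f (Iio c) c := by
    simpa using (hf.neg.hasDerivWithinAt_leftDeriv_of_mem_interior hc).differentiableWithinAt.neg
  have hd' : DifferentiableWithinAt ℝ f (Ioi c) c := by
    simpa using (hf.neg.hasDerivWithinAt_rightDeriv_of_mem_interior hc).differentiableWithinAt.neg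
  have hlr : derivWithin f (Ioi c) c ≤ derivWithin f (Iio c) c := by
    have := hf.neg.leftDeriv_le_rightDeriv_of_mem_interior hc
    simpa [derivWithin.neg, derivWithin.fun_neg] using this
  refine ⟨derivWithin f (Iio c) c, fun x hx => ?_⟩
  rcases lt_trichotomy x c with h | rfl | h
  · have := hf.leftDeriv_le_slope hx hcS h hd
    rw [slope_def_field, le_div_iff₀ (by linarith)] at this
    linarith
  · simp
  · have := (hf.slope_le_rightDeriv hcS hx h hd').trans hlr
    rw [slope_def_field, div_le_iff₀ (by linarith)] at this
    linarith

/-- If `μ {x | s ≤ Y x} ≤ μ univ * exp (-s)` for all `s > 0`, then the mean of `Y` is at most `1`. -/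
theorem integral_le_measureReal_univ_of_tail_le {X : Type*} [MeasurableSpace X] {μ : Measure X}
    [IsFiniteMeasure μ] {Y : X → ℝ} (hY : Integrable Y μ)
    (htail : ∀ s > 0, μ.real {x | s ≤ Y x} ≤ μ.real univ * Real.exp (-s)) :
    ∫ x, Y x ∂μ ≤ μ.real univ := by
  have hint : IntegrableOn (fun s : ℝ => μ.real univ * Real.exp (-s)) (Ioi 0) :=
    (integrableOn_exp_neg_Ioi 0).const_mul _
  calc ∫ x, Y x ∂μ ≤ ∫ x, max (Y x) 0 ∂μ :=
        integral_mono hY hY.pos_part fun x => le_max_left _ _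
    _ = ∫ s in Ioi (0 : ℝ), μ.real {x | s ≤ max (Y x) 0} :=
        hY.pos_part.integral_eq_integral_meas_le (.of_forall fun x => le_max_right _ _)
    _ ≤ ∫ s in Ioi (0 : ℝ), μ.real univ * Real.exp (-s) := by
        refine integral_mono_of_nonneg (.of_forall fun _ => measureReal_nonneg) hint ?_
        filter_upwards [ae_restrict_mem measurableSet_Ioi] with s (hs : 0 < s)
        simpa [le_max_iff, hs.not_ge] using htail s hs
    _ = μ.real univ := by
        rw [integral_const_mul, integral_exp_neg_Ioi_zero, mul_one]

/-- Grünbaum's inequality for a random variable with log-concave distribution function. -/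
theorem measureReal_le_of_logConcave_cdf {X : Type*} [MeasurableSpace X] {μ : Measure X}
    [IsFiniteMeasure μ] {φ : X → ℝ} (hφ : Integrable φ μ) {c : ℝ}
    (hc : ∫ x, φ x ∂μ = c * μ.real univ) (hatom : ∀ᵐ x ∂μ, φ x ≠ c)
    (hF : ∀ a b : ℝ, 0 < a → 0 < b → a + b = 1 → ∀ s t : ℝ,
      μ.real {x | φ x ≤ s} ^ a * μ.real {x | φ x ≤ t} ^ b ≤ μ.real {x | φ x ≤ a * s + b * t}) :
    (Real.exp 1)⁻¹ * μ.real univ ≤ μ.real {x | φ x ≤ c} := by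
  rcases eq_or_ne μ 0 with rfl | hμ
  · simp
  have hV : 0 < μ.real univ := by
    have : NeZero μ := ⟨hμ⟩
    exact measureReal_univ_pos
  set F : ℝ → ℝ := fun t => μ.real {x | φ x ≤ t}
  have hFmono : Monotone F := fun s t hst =>
    measureReal_mono fun x (hx : φ x ≤ s) => hx.trans hst
  obtain ⟨t₀, ht₀c, ht₀⟩ : ∃ t < c, 0 < F t := by
    by_contra! h
    have hge : ∀ᵐ x ∂μ, c ≤ φ x := by
      have : ∀ t < c, ∀ᵐ x ∂μ, t < φ x := fun t ht => by
        have h0 : μ {x | φ x ≤ t} = 0 :=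
          (measureReal_eq_zero_iff).1 (le_antisymm (h t ht) measureReal_nonneg)
        simpa [ae_iff] using h0
      obtain ⟨u, -, hu, hlim⟩ := exists_seq_strictMono_tendsto c
      filter_upwards [ae_all_iff.2 fun n => this (u n) (hu n)] with x hx
      exact le_of_tendsto' hlim fun n => (hx n).le
    have h0 : ∫ x, (φ x - c) ∂μ = 0 := by
      rw [integral_sub hφ (integrable_const c), hc]
      simp [mul_comm]
    have h1 := (integral_eq_zero_iff_of_nonneg_ae
      (by filter_upwards [hge] with x hx using sub_nonneg.2 hx)
      (hφ.sub (integrable_const c))).1 h0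
    have : ∀ᵐ x ∂μ, False := by
      filter_upwards [h1, hatom] with x hx hx'
      exact hx' (sub_eq_zero.1 hx)
    exact hμ (by simpa using this)
  have hFc : 0 < F c := ht₀.trans_le (hFmono ht₀c.le)
  have hconc : ConcaveOn ℝ {t | 0 < F t} (fun t => Real.log (F t)) := by
    have hpos : ∀ {a b : ℝ}, ∀ {s t : ℝ}, 0 < F s → 0 < F t → 0 < F s ^ a * F t ^ b :=
      fun hs ht => mul_pos (Real.rpow_pos_of_pos hs _) (Real.rpow_pos_of_pos ht _)
    refine concaveOn_iff_forall_pos.2 ⟨convex_iff_forall_pos.2 ?_, ?_⟩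
    · intro s hs t ht a b ha hb hab
      exact (hpos hs ht).trans_le (hF a b ha hb hab s t)
    · intro s hs t ht a b ha hb hab
      have := Real.log_le_log (hpos hs ht) (hF a b ha hb hab s t)
      rwa [Real.log_mul (Real.rpow_pos_of_pos hs _).ne' (Real.rpow_pos_of_pos ht _).ne',
        Real.log_rpow hs, Real.log_rpow ht] at this
  have hint : c ∈ interior {t | 0 < F t} :=
    interior_maximal (fun t ht => ht₀.trans_le (hFmono (le_of_lt ht))) isOpen_Ioi ht₀c
  obtain ⟨m, hm⟩ := hconc.exists_le_add_mul hint
  have hm0 : 0 ≤ m := by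
    have h1 : F c ≤ F (c + 1) := hFmono (by linarith)
    have := hm (c + 1) (hFc.trans_le h1)
    have := Real.log_le_log hFc h1
    linarith
  have hFle : ∀ t, F t ≤ F c * Real.exp (m * (t - c)) := by
    intro t
    have hFt : 0 ≤ F t := measureReal_nonneg
    rcases hFt.eq_or_lt with h | h
    · rw [← h]; positivity
    · calc F t = Real.exp (Real.log (F t)) := (Real.exp_log h).symm
        _ ≤ Real.exp (Real.log (F c) + m * (t - c)) := Real.exp_le_exp.2 (hm t h)
        _ = F c * Real.exp (m * (t - c)) := by rw [Real.exp_add, Real.exp_log hFc]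
  rcases hm0.eq_or_lt with rfl | hm0
  · have hV' : μ.real univ ≤ F c := by
      have hmono : Monotone fun n : ℕ => {x | φ x ≤ n} := fun i j hij x (hx : φ x ≤ i) =>
        hx.trans (Nat.cast_le.2 hij)
      have hU : ⋃ n : ℕ, {x | φ x ≤ n} = univ :=
        eq_univ_of_forall fun x => mem_iUnion.2 (exists_nat_ge (φ x))
      refine ENNReal.toReal_mono (measure_ne_top _ _) ?_
      rw [← hU, hmono.measure_iUnion]
      refine iSup_le fun n => (ENNReal.toReal_le_toReal (measure_ne_top _ _)
        (measure_ne_top _ _)).1 ?_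
      have := hFle n
      rwa [zero_mul, Real.exp_zero, mul_one] at this
    refine le_trans (mul_le_of_le_one_left hV.le (inv_le_one_of_one_le₀ ?_)) hV'
    exact Real.one_le_exp zero_le_one
  set L := Real.log (μ.real univ / F c)
  have hexpL : Real.exp L = μ.real univ / F c := Real.exp_log (div_pos hV hFc)
  have hL1 : L ≤ 1 := by
    have hφc : Integrable (fun x => φ x - c) μ := hφ.sub (integrable_const c)
    have hY : Integrable (fun x => L - m * (φ x - c)) μ :=
      (integrable_const L).sub (hφc.const_mul m)
    have key := integral_le_measureReal_univ_of_tail_le hY fun s hs => ?_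
    · rw [integral_sub (integrable_const L) (hφc.const_mul m),
        integral_const_mul, integral_sub hφ (integrable_const c), hc] at key
      simp only [integral_const, smul_eq_mul] at key
      nlinarith
    · have hexp : F c * Real.exp (L - s) = μ.real univ * Real.exp (-s) := by
        rw [sub_eq_add_neg, Real.exp_add, hexpL]
        field_simp
      rw [← hexp]
      have := hFle (c + (L - s) / m)
      rw [add_sub_cancel_left, mul_div_cancel₀ _ hm0.ne'] at this
      refine le_trans (measureReal_mono ?_) this
      intro x (hx : s ≤ L - m * (φ x - c))
      have : φ x - c ≤ (L - s) / m := by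
        rw [le_div_iff₀ hm0]; linarith
      change φ x ≤ _
      linarith
  have h3 : μ.real univ / F c ≤ Real.exp 1 := hexpL ▸ Real.exp_le_exp.2 hL1
  rw [inv_mul_le_iff₀ (Real.exp_pos 1)]
  rwa [div_le_iff₀ hFc] at h3

theorem volume_setOf_inner_eq {E : Type*} [NormedAddCommGroup E] [InnerProductSpace ℝ E]
    [FiniteDimensional ℝ E] [MeasurableSpace E] [BorelSpace E] {v : E} (hv : v ≠ 0) (c : ℝ) :
    volume {x : E | ⟪v, x⟫ = c} = 0 := by
  let s : AffineSubspace ℝ E :=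
    (AffineSubspace.mk' c (⊥ : Submodule ℝ ℝ)).comap (innerₛₗ ℝ v).toAffineMap
  have hs : (s : Set E) = {x : E | ⟪v, x⟫ = c} := by
    ext x
    simp [s, AffineSubspace.mem_mk', sub_eq_zero]
  rw [← hs]
  refine Measure.addHaar_affineSubspace _ _ fun htop => hv ?_
  have hall : ∀ x : E, ⟪v, x⟫ = c := fun x => by
    have : x ∈ (s : Set E) := by simp [htop]
    rwa [hs] at this
  have h0 := hall 0
  rw [inner_zero_right] at h0
  exact inner_self_eq_zero.1 ((hall v).trans h0.symm)

/-- Grünbaum's inequality for the half of `K` on which the functional `⟪v, ·⟫` is at most its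
mean over `K`. -/
theorem grunbaum_le (d : ℕ) (K : Set (EuclideanSpace ℝ (Fin d)))
    (hKc : IsCompact K) (hKconv : Convex ℝ K)
    (v : EuclideanSpace ℝ (Fin d)) (hv : v ≠ 0) (c : ℝ)
    (hcg : ∫ x in K, ⟪v, x⟫ = c * (volume K).toReal) :
    (Real.exp 1)⁻¹ * (volume K).toReal ≤ (volume (K ∩ {x | ⟪v, x⟫ ≤ c})).toReal := by
  have : IsFiniteMeasure (volume.restrict K) := ⟨by simpa using hKc.measure_lt_top⟩
  have hcont : Continuous fun x : EuclideanSpace ℝ (Fin d) => ⟪v, x⟫ := by fun_prop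
  have hset : ∀ t, MeasurableSet {x : EuclideanSpace ℝ (Fin d) | ⟪v, x⟫ ≤ t} := fun t =>
    (isClosed_le hcont continuous_const).measurableSet
  have hreal : ∀ t, (volume.restrict K).real {x | ⟪v, x⟫ ≤ t} =
      (volume (K ∩ {x | ⟪v, x⟫ ≤ t})).toReal := fun t => by
    rw [measureReal_def, Measure.restrict_apply (hset t), inter_comm]
  have huniv : (volume.restrict K).real univ = (volume K).toReal := by simp [measureReal_def]
  rw [← hreal, ← huniv]
  refine measureReal_le_of_logConcave_cdf (hcont.continuousOn.integrableOn_compact hKc)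
    (by rw [huniv, hcg]) (ae_restrict_of_ae ?_) fun a b ha hb hab s t => ?_
  · simpa [ae_iff] using volume_setOf_inner_eq hv c
  · have hmeas : ∀ t, MeasurableSet (K ∩ {x | ⟪v, x⟫ ≤ t}) := fun t =>
      hKc.measurableSet.inter (hset t)
    have := (EuclideanSpace.prekopaLeindler d).measure_rpow_mul_le ha hb hab (hmeas s) (hmeas t)
      (hmeas (a * s + b * t)) ?_
    · simp only [hreal, ENNReal.toReal_rpow, ← ENNReal.toReal_mul]
      exact ENNReal.toReal_mono (measure_ne_top_of_subset inter_subset_left hKc.measure_ne_top) this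
    · rintro x ⟨hxK, hx : ⟪v, x⟫ ≤ s⟩ y ⟨hyK, hy : ⟪v, y⟫ ≤ t⟩
      refine ⟨hKconv hxK hyK ha.le hb.le hab, ?_⟩
      change ⟪v, a • x + b • y⟫ ≤ _
      rw [inner_add_right, inner_smul_right, inner_smul_right]
      gcongr

/-- Grünbaum's theorem: any hyperplane through the center of gravity of a compact
convex body K ⊂ ℝ^d divides K into two pieces, each of volume at least e⁻¹·Vol(K). -/
theorem grunbaum (d : ℕ) (K : Set (EuclideanSpace ℝ (Fin d)))
    (hKc : IsCompact K) (hKconv : Convex ℝ K) (hKint : (interior K).Nonempty)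
    (v : EuclideanSpace ℝ (Fin d)) (hv : v ≠ 0) (c : ℝ)
    (hcg : ⟪v, (volume K).toReal⁻¹ • ∫ x in K, x⟫ = c) :
    (Real.exp 1)⁻¹ * (volume K).toReal ≤ (volume (K ∩ {x | c ≤ ⟪v, x⟫})).toReal ∧
    (Real.exp 1)⁻¹ * (volume K).toReal ≤ (volume (K ∩ {x | ⟪v, x⟫ ≤ c})).toReal := by
  have hV : (volume K).toReal ≠ 0 := ENNReal.toReal_ne_zero.2
    ⟨(Measure.measure_pos_of_nonempty_interior _ hKint).ne', hKc.measure_ne_top⟩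
  have hint : IntegrableOn (fun x : EuclideanSpace ℝ (Fin d) => x) K :=
    continuousOn_id.integrableOn_compact hKc
  have hmean : ∫ x in K, ⟪v, x⟫ = c * (volume K).toReal := by
    rw [integral_inner hint, ← hcg, inner_smul_right]
    field_simp
  refine ⟨?_, grunbaum_le d K hKc hKconv v hv c hmean⟩
  have := grunbaum_le d K hKc hKconv (-v) (neg_ne_zero.2 hv) (-c)
    (by simp only [inner_neg_left, integral_neg, hmean, neg_mul])
  simpa only [inner_neg_left, neg_le_neg_iff] using this
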